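/- arXiv:1403.3901 — 4 statements merged into one kernel-verified Lean document; each statement's English description precedes it below -/
import Mathlib

section
/- For ε₂ = 0, the derivative of F₁ in virtue of the equations of motion satisfies {H,F₁} = 2ε₁(α₁+β₂)F₁ at every point of ℝ⁹, for all real values of λ and ε₁. -/
noncomputable section

/-- The phase space `ℝ⁹` with coordinates `(M₁,M₂,M₃,α₁,α₂,α₃,β₁,β₂,β₃)`. -/
abbrev V9 : Type := Fin 9 → ℝ

/-- Index of `M_i` among the nine coordinates. -/
def mIdx (i : Fin 3) : Fin 9 := ⟨i.1, by have := i.isLt; omega⟩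
/-- Index of `α_i` among the nine coordinates. -/
def aIdx (i : Fin 3) : Fin 9 := ⟨i.1 + 3, by have := i.isLt; omega⟩
/-- Index of `β_i` among the nine coordinates. -/
def bIdx (i : Fin 3) : Fin 9 := ⟨i.1 + 6, by have := i.isLt; omega⟩

/-- The Levi-Civita symbol `ε_{ijk} = ½(i−j)(j−k)(k−i)`. -/
def epsSym (i j k : Fin 3) : ℝ :=
  (((i.1 : ℝ) - (j.1 : ℝ)) * ((j.1 : ℝ) - (k.1 : ℝ)) * ((k.1 : ℝ) - (i.1 : ℝ))) / 2

/-- Partial derivative of `f : ℝ⁹ → ℝ` in the `i`-th coordinate direction. -/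
def pd (i : Fin 9) (f : V9 → ℝ) (x : V9) : ℝ := fderiv ℝ f x (Pi.single i 1)

/-- The Lie–Poisson bracket of the Lie coalgebra `e(3,2)*`. -/
def pb (f g : V9 → ℝ) (x : V9) : ℝ :=
  ∑ i : Fin 3, ∑ j : Fin 3, ∑ k : Fin 3, epsSym i j k *
    (pd (mIdx i) f x * pd (mIdx j) g x * x (mIdx k)
      + (pd (mIdx i) f x * pd (aIdx j) g x - pd (mIdx i) g x * pd (aIdx j) f x) * x (aIdx k)
      + (pd (mIdx i) f x * pd (bIdx j) g x - pd (mIdx i) g x * pd (bIdx j) f x) * x (bIdx k))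

/-- The Hamiltonian `H` of the generalized two-field gyrostat. -/
def Hfun (lam e1 e2 : ℝ) : V9 → ℝ := fun x =>
  x 0 ^ 2 + x 1 ^ 2 + 2 * x 2 ^ 2 + 2 * lam * x 2 - 2 * e2 * (x 3 + x 7)
    + 2 * e1 * (x 1 * x 5 - x 2 * x 4 + x 2 * x 6 - x 0 * x 8)

/-- The invariant relation `F₁ = M₃ + λ + ε₁(β₁ − α₂)`. -/
def F1 (lam e1 : ℝ) : V9 → ℝ := fun x => x 2 + lam + e1 * (x 6 - x 4)

theorem hasFDerivAt_coord (i : Fin 9) (x : V9) :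
    HasFDerivAt (fun y : V9 => y i)
      (ContinuousLinearMap.proj (R := ℝ) (φ := fun _ : Fin 9 => ℝ) i) x :=
  (ContinuousLinearMap.proj (R := ℝ) (φ := fun _ : Fin 9 => ℝ) i).hasFDerivAt

theorem fderiv_Hfun_apply (lam e1 : ℝ) (x v : V9) :
    fderiv ℝ (Hfun lam e1 0) x v =
      2 * x 0 * v 0 + 2 * x 1 * v 1 + 4 * x 2 * v 2 + 2 * lam * v 2
        + 2 * e1 * (x 1 * v 5 + x 5 * v 1 - (x 2 * v 4 + x 4 * v 2)
          + (x 2 * v 6 + x 6 * v 2) - (x 0 * v 8 + x 8 * v 0)) := by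
  have c := fun i => hasFDerivAt_coord i x
  have h := (((((((c 0).pow 2).add ((c 1).pow 2)).add (((c 2).pow 2).const_mul 2)).add
    ((c 2).const_mul (2 * lam))).sub (((c 3).add (c 7)).const_mul (2 * 0))).add
    ((((((c 1).mul (c 5)).sub ((c 2).mul (c 4))).add ((c 2).mul (c 6))).sub
      ((c 0).mul (c 8))).const_mul (2 * e1)))
  have hH : HasFDerivAt (Hfun lam e1 0) _ x := h
  rw [hH.fderiv]
  simp
  ring

theorem fderiv_F1_apply (lam e1 : ℝ) (x v : V9) :
    fderiv ℝ (F1 lam e1) x v = v 2 + e1 * (v 6 - v 4) := by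
  have c := fun i => hasFDerivAt_coord i x
  have hF : HasFDerivAt (F1 lam e1) _ x :=
    ((c 2).add_const lam).add (((c 6).sub (c 4)).const_mul e1)
  rw [hF.fderiv]
  simp

/-- For `ε₂ = 0`, `{H, F₁} = 2ε₁(α₁+β₂)F₁` everywhere. -/
theorem bracket_H_F1 (lam e1 : ℝ) (x : V9) :
    pb (Hfun lam e1 0) (F1 lam e1) x = 2 * e1 * (x 3 + x 7) * F1 lam e1 x := by
  simp only [pb, pd, fderiv_Hfun_apply, fderiv_F1_apply, F1, Fin.sum_univ_three, epsSym, mIdx,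
    aIdx, bIdx]
  simp [Fin.ext_iff]
  ring
end
end

section
/- For ε₂ = 0, the derivative of F₂ in virtue of the equations of motion satisfies {H,F₂} = −2ε₁(α₁+β₂)F₂ at every point of ℝ⁹, for all real values of λ and ε₁. -/
noncomputable section

/-- The invariant relation `F₂`. -/
def F2 (lam e1 : ℝ) : V9 → ℝ := fun x =>
  x 2 ^ 3 + (e1 * (x 6 - x 4) + lam) * x 2 ^ 2
    + (x 0 ^ 2 + x 1 ^ 2 + 2 * e1 * (x 5 * x 1 - x 8 * x 0)) * x 2
    + e1 * ((x 1 ^ 2 - x 0 ^ 2) * (x 4 + x 6) + 2 * x 0 * x 1 * (x 3 - x 7))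
    + lam * (x 0 ^ 2 + x 1 ^ 2)

/-- The gradient of the Hamiltonian at `ε₂ = 0`. -/
lemma pd_Hfun (lam e1 : ℝ) (x : V9) (i : Fin 9) :
    pd i (Hfun lam e1 0) x =
      ![2 * x 0 - 2 * e1 * x 8, 2 * x 1 + 2 * e1 * x 5,
        4 * x 2 + 2 * lam + 2 * e1 * (x 6 - x 4), 0, -(2 * e1 * x 2), 2 * e1 * x 1,
        2 * e1 * x 2, 0, -(2 * e1 * x 0)] i := by
  have h (j : Fin 9) : HasFDerivAt (fun y : V9 => y j)
      (ContinuousLinearMap.proj (R := ℝ) (φ := fun _ : Fin 9 => ℝ) j) x := hasFDerivAt_apply j x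
  have hH := ((((((h 0).pow 2).add ((h 1).pow 2)).add (((h 2).pow 2).const_mul 2)).add
    ((h 2).const_mul (2 * lam))).sub (((h 3).add (h 7)).const_mul (2 * 0))).add
    ((((((h 1).mul (h 5)).sub ((h 2).mul (h 4))).add ((h 2).mul (h 6))).sub
      ((h 0).mul (h 8))).const_mul (2 * e1))
  have hpd : pd i (Hfun lam e1 0) x = _ := congrArg (fun L => L (Pi.single i 1)) hH.fderiv
  rw [hpd]
  fin_cases i <;> simp <;> ring

/-- The gradient of the invariant relation `F₂`. -/
lemma pd_F2 (lam e1 : ℝ) (x : V9) (i : Fin 9) :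
    pd i (F2 lam e1) x =
      ![(2 * x 0 - 2 * e1 * x 8) * x 2
          + e1 * (2 * x 1 * (x 3 - x 7) - 2 * x 0 * (x 4 + x 6)) + 2 * lam * x 0,
        (2 * x 1 + 2 * e1 * x 5) * x 2
          + e1 * (2 * x 1 * (x 4 + x 6) + 2 * x 0 * (x 3 - x 7)) + 2 * lam * x 1,
        3 * x 2 ^ 2 + 2 * (e1 * (x 6 - x 4) + lam) * x 2
          + (x 0 ^ 2 + x 1 ^ 2 + 2 * e1 * (x 5 * x 1 - x 8 * x 0)),
        2 * e1 * x 0 * x 1, e1 * (x 1 ^ 2 - x 0 ^ 2 - x 2 ^ 2), 2 * e1 * x 1 * x 2,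
        e1 * (x 1 ^ 2 - x 0 ^ 2 + x 2 ^ 2), -(2 * e1 * x 0 * x 1),
        -(2 * e1 * x 0 * x 2)] i := by
  have h (j : Fin 9) : HasFDerivAt (fun y : V9 => y j)
      (ContinuousLinearMap.proj (R := ℝ) (φ := fun _ : Fin 9 => ℝ) j) x := hasFDerivAt_apply j x
  have hF := (((((h 2).pow 3).add
    (((((h 6).sub (h 4)).const_mul e1).add_const lam).mul ((h 2).pow 2))).add
    (((((h 0).pow 2).add ((h 1).pow 2)).add
      ((((h 5).mul (h 1)).sub ((h 8).mul (h 0))).const_mul (2 * e1))).mul (h 2))).add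
    ((((((h 1).pow 2).sub ((h 0).pow 2)).mul ((h 4).add (h 6))).add
      ((((h 0).const_mul 2).mul (h 1)).mul ((h 3).sub (h 7)))).const_mul e1)).add
    ((((h 0).pow 2).add ((h 1).pow 2)).const_mul lam)
  have hpd : pd i (F2 lam e1) x = _ := congrArg (fun L => L (Pi.single i 1)) hF.fderiv
  rw [hpd]
  fin_cases i <;> simp <;> ring

/-- For `ε₂ = 0`, `{H, F₂} = −2ε₁(α₁+β₂)F₂` everywhere. -/
theorem bracket_H_F2 (lam e1 : ℝ) (x : V9) :
    pb (Hfun lam e1 0) (F2 lam e1) x = -(2 * e1 * (x 3 + x 7)) * F2 lam e1 x := by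
  simp only [pb, pd_Hfun, pd_F2, Fin.sum_univ_three]
  simp [epsSym, mIdx, aIdx, bIdx, F2]
  ring
end
end

section
/- For ε₂ = 0, the set {M₁ = 0, M₂ = 0} is invariant under the flow of the generalized two-field gyrostat: if γ: ℝ → ℝ⁹ is a differentiable solution of the equations of motion with M₁(γ(0)) = 0 and M₂(γ(0)) = 0, then M₁(γ(t)) = 0 and M₂(γ(t)) = 0 for all t ∈ ℝ. -/
noncomputable section

/-- Vectors in `ℝ³`. -/
abbrev R3 : Type := Fin 3 → ℝ

/-- The Hamiltonian `H` (with `ε₂ = 0`) as a function of `M`, `α`, `β`. -/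
def H3 (lam e1 : ℝ) (M a b : R3) : ℝ :=
  M 0 ^ 2 + M 1 ^ 2 + 2 * M 2 ^ 2 + 2 * lam * M 2
    + 2 * e1 * (M 1 * a 2 - M 2 * a 1 + M 2 * b 0 - M 0 * b 2)

/-- The gradient `∂H/∂M`. -/
def gradM (lam e1 : ℝ) (M a b : R3) : R3 := fun i =>
  fderiv ℝ (fun M' => H3 lam e1 M' a b) M (Pi.single i 1)
/-- The gradient `∂H/∂α`. -/
def gradA (lam e1 : ℝ) (M a b : R3) : R3 := fun i =>
  fderiv ℝ (fun a' => H3 lam e1 M a' b) a (Pi.single i 1)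
/-- The gradient `∂H/∂β`. -/
def gradB (lam e1 : ℝ) (M a b : R3) : R3 := fun i =>
  fderiv ℝ (fun b' => H3 lam e1 M a b') b (Pi.single i 1)

/-- A curve `(M,α,β) : ℝ → ℝ⁹` solves the equations of motion of the generalized
two-field gyrostat (with `ε₂ = 0`). -/
def SolvesEqs (lam e1 : ℝ) (γM γa γb : ℝ → R3) : Prop :=
  (∀ t, HasDerivAt γM
      (crossProduct (γM t) (gradM lam e1 (γM t) (γa t) (γb t))
        + crossProduct (γa t) (gradA lam e1 (γM t) (γa t) (γb t))
        + crossProduct (γb t) (gradB lam e1 (γM t) (γa t) (γb t))) t)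
  ∧ (∀ t, HasDerivAt γa (crossProduct (γa t) (gradM lam e1 (γM t) (γa t) (γb t))) t)
  ∧ (∀ t, HasDerivAt γb (crossProduct (γb t) (gradM lam e1 (γM t) (γa t) (γb t))) t)

/-- A solution of a linear ordinary differential equation with continuous coefficients that
vanishes at one time vanishes identically. -/
theorem eq_zero_of_hasDerivAt_clm {E : Type*} [NormedAddCommGroup E] [NormedSpace ℝ E]
    {A : ℝ → E →L[ℝ] E} (hA : Continuous A) {x : ℝ → E} {t₀ : ℝ}
    (hx : ∀ t, HasDerivAt x (A t (x t)) t) (h0 : x t₀ = 0) (t : ℝ) : x t = 0 := by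
  obtain ⟨a, ha⟩ := exists_lt (min t₀ t)
  obtain ⟨b, hb⟩ := exists_gt (max t₀ t)
  rw [lt_min_iff] at ha
  rw [max_lt_iff] at hb
  obtain ⟨C, hC⟩ := isCompact_Icc.exists_bound_of_continuousOn (s := Set.Icc a b) hA.continuousOn
  refine ODE_solution_unique_of_mem_Icc (v := fun t => A t) (s := fun _ => Set.univ)
    (K := C.toNNReal) (f := x) (g := fun _ => 0) (t₀ := t₀) (a := a) (b := b)
    (fun τ hτ => ((A τ).lipschitz.weaken ?_).lipschitzOnWith)
    ⟨ha.1, hb.1⟩ (fun τ _ => (hx τ).continuousAt.continuousWithinAt) (fun τ _ => hx τ)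
    (fun _ _ => trivial) continuousOn_const (fun τ _ => ?_) (fun _ _ => trivial) h0
    ⟨ha.2.le, hb.2.le⟩
  · exact NNReal.le_toNNReal_of_coe_le (hC τ (Set.Ioo_subset_Icc_self hτ))
  · simpa using hasDerivAt_const τ (0 : E)

/-- Uniqueness of the zero solution of a planar linear system with continuous coefficients. -/
theorem eq_zero_of_hasDerivAt_planar {p q r s x y : ℝ → ℝ} (hp : Continuous p)
    (hq : Continuous q) (hr : Continuous r) (hs : Continuous s) {t₀ : ℝ}
    (hx : ∀ t, HasDerivAt x (p t * x t + q t * y t) t)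
    (hy : ∀ t, HasDerivAt y (r t * x t + s t * y t) t)
    (hx0 : x t₀ = 0) (hy0 : y t₀ = 0) (t : ℝ) : x t = 0 ∧ y t = 0 := by
  let fst := ContinuousLinearMap.fst ℝ ℝ ℝ
  let snd := ContinuousLinearMap.snd ℝ ℝ ℝ
  let inl := ContinuousLinearMap.inl ℝ ℝ ℝ
  let inr := ContinuousLinearMap.inr ℝ ℝ ℝ
  have hA : Continuous fun t => p t • inl.comp fst + q t • inl.comp snd
      + r t • inr.comp fst + s t • inr.comp snd := by fun_prop
  have h := eq_zero_of_hasDerivAt_clm hA (x := fun t => (x t, y t)) (t₀ := t₀)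
    (fun t => ((hx t).prodMk (hy t)).congr_deriv (by ext <;> simp [fst, snd, inl, inr]))
    (by simp [hx0, hy0]) t
  simpa using h

theorem gradM_eq (lam e1 : ℝ) (M a b : R3) :
    gradM lam e1 M a b = ![2 * M 0 - 2 * e1 * b 2, 2 * M 1 + 2 * e1 * a 2,
      4 * M 2 + 2 * lam + 2 * e1 * (b 0 - a 1)] := by
  have hd (i : Fin 3) : HasFDerivAt (fun N : R3 => N i)
      (ContinuousLinearMap.proj (R := ℝ) (φ := fun _ : Fin 3 => ℝ) i) M :=
    hasFDerivAt_apply i M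
  have h := (((((hd 0).pow 2).add ((hd 1).pow 2)).add (((hd 2).pow 2).const_mul 2)).add
    ((hd 2).const_mul (2 * lam))).add
    ((((((hd 1).mul_const (a 2)).sub ((hd 2).mul_const (a 1))).add
      ((hd 2).mul_const (b 0))).sub ((hd 0).mul_const (b 2))).const_mul (2 * e1))
  ext i
  unfold gradM
  erw [h.fderiv]
  fin_cases i <;> simp <;> ring

theorem gradA_eq (lam e1 : ℝ) (M a b : R3) :
    gradA lam e1 M a b = ![0, -(2 * e1 * M 2), 2 * e1 * M 1] := by
  have hd (i : Fin 3) : HasFDerivAt (fun N : R3 => N i)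
      (ContinuousLinearMap.proj (R := ℝ) (φ := fun _ : Fin 3 => ℝ) i) a :=
    hasFDerivAt_apply i a
  have h := ((((((hd 2).const_mul (M 1)).sub ((hd 1).const_mul (M 2))).add_const
    (M 2 * b 0)).sub_const (M 0 * b 2)).const_mul (2 * e1)).const_add
    (M 0 ^ 2 + M 1 ^ 2 + 2 * M 2 ^ 2 + 2 * lam * M 2)
  ext i
  unfold gradA
  erw [h.fderiv]
  fin_cases i <;> simp

theorem gradB_eq (lam e1 : ℝ) (M a b : R3) :
    gradB lam e1 M a b = ![2 * e1 * M 2, 0, -(2 * e1 * M 0)] := by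
  have hd (i : Fin 3) : HasFDerivAt (fun N : R3 => N i)
      (ContinuousLinearMap.proj (R := ℝ) (φ := fun _ : Fin 3 => ℝ) i) b :=
    hasFDerivAt_apply i b
  have h := (((((hd 0).const_mul (M 2)).const_add (M 1 * a 2 - M 2 * a 1)).sub
    ((hd 2).const_mul (M 0))).const_mul (2 * e1)).const_add
    (M 0 ^ 2 + M 1 ^ 2 + 2 * M 2 ^ 2 + 2 * lam * M 2)
  ext i
  unfold gradB
  erw [h.fderiv]
  fin_cases i <;> simp

/-- For `ε₂ = 0`, the set `{M₁ = 0, M₂ = 0}` is invariant under the flow of the generalized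
two-field gyrostat. -/
theorem invariance_M1_M2 (lam e1 : ℝ) (γM γa γb : ℝ → R3)
    (hsol : SolvesEqs lam e1 γM γa γb)
    (h10 : γM 0 0 = 0) (h20 : γM 0 1 = 0) :
    ∀ t : ℝ, γM t 0 = 0 ∧ γM t 1 = 0 := by
  obtain ⟨hM, ha, hb⟩ := hsol
  have hcM : Continuous γM := continuous_iff_continuousAt.2 fun t => (hM t).continuousAt
  have hca : Continuous γa := continuous_iff_continuousAt.2 fun t => (ha t).continuousAt
  have hcb : Continuous γb := continuous_iff_continuousAt.2 fun t => (hb t).continuousAt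
  refine eq_zero_of_hasDerivAt_planar
    (x := fun t => γM t 0) (y := fun t => γM t 1)
    (p := fun t => -(2 * e1 * γb t 1)) (q := fun t => 2 * γM t 2 + 2 * lam + 2 * e1 * γb t 0)
    (r := fun t => -(2 * γM t 2) - 2 * lam + 2 * e1 * γa t 1) (s := fun t => -(2 * e1 * γa t 0))
    (by fun_prop) (by fun_prop) (by fun_prop) (by fun_prop)
    (fun t => ?_) (fun t => ?_) h10 h20
  · refine (hasDerivAt_pi.1 (hM t) 0).congr_deriv ?_
    simp [gradM_eq, gradA_eq, gradB_eq, cross_apply]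
    ring
  · refine (hasDerivAt_pi.1 (hM t) 1).congr_deriv ?_
    simp [gradM_eq, gradA_eq, gradB_eq, cross_apply]
    ring
end
end

section
/- For ε₂ = 0, at every point x₀ ∈ ℝ⁹ with F₁(x₀) = 0 and F₂(x₀) = 0, the linearization A of the Hamiltonian vector field sgrad Φ₁ at x₀ (the Fréchet derivative at x₀ of the map x ↦ sgrad Φ₁(x), a linear endomorphism of ℝ⁹) has characteristic polynomial det(X·I − A) = X⁹ − F₀(x₀)²·X⁷; in particular the coefficient C of the characteristic polynomial satisfies C = ½ tr(A²) = F₀(x₀)². -/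
noncomputable section

/-- `|α|²`. -/
def nA2 : V9 → ℝ := fun x => x 3 ^ 2 + x 4 ^ 2 + x 5 ^ 2
/-- `|β|²`. -/
def nB2 : V9 → ℝ := fun x => x 6 ^ 2 + x 7 ^ 2 + x 8 ^ 2
/-- `α·β`. -/
def dotAB : V9 → ℝ := fun x => x 3 * x 6 + x 4 * x 7 + x 5 * x 8

/-- `ω_α = α·M`. -/
def wA : V9 → ℝ := fun x => x 3 * x 0 + x 4 * x 1 + x 5 * x 2
/-- `ω_β = β·M`. -/
def wB : V9 → ℝ := fun x => x 6 * x 0 + x 7 * x 1 + x 8 * x 2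
/-- `ω_γ = M·(α×β)`. -/
def wG : V9 → ℝ := fun x =>
  x 0 * (x 4 * x 8 - x 7 * x 5) + x 1 * (x 5 * x 6 - x 3 * x 8) + x 2 * (x 3 * x 7 - x 4 * x 6)

/-- The auxiliary function `Z₁`. -/
def Z1 (e1 e2 : ℝ) : V9 → ℝ := fun x =>
  (x 0 ^ 2 - x 1 ^ 2) / 2 + e2 * (x 3 - x 7)
    + e1 * (x 2 * (x 4 + x 6) - x 1 * x 5 - x 0 * x 8) + e1 ^ 2 * (nB2 x - nA2 x) / 2

/-- The auxiliary function `Z₂`. -/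
def Z2 (e1 e2 : ℝ) : V9 → ℝ := fun x =>
  x 0 * x 1 + e2 * (x 4 + x 6) - e1 * (x 2 * (x 3 - x 7) + x 8 * x 1 - x 5 * x 0)
    - e1 ^ 2 * dotAB x

/-- The first integral `K`. -/
def Kfun (lam e1 e2 : ℝ) : V9 → ℝ := fun x =>
  Z1 e1 e2 x ^ 2 + Z2 e1 e2 x ^ 2
    - lam * ((x 2 + lam) * (x 0 ^ 2 + x 1 ^ 2) + 2 * e2 * (x 5 * x 0 + x 8 * x 1))
    + lam * e1 ^ 2 * (nA2 x + nB2 x) * x 2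
    + 2 * lam * e1 * (x 4 * x 0 ^ 2 - x 6 * x 1 ^ 2 - (x 3 - x 7) * x 0 * x 1)
    - 2 * lam * e1 ^ 2 * wG x

/-- The first integral `G`. -/
def Gfun (lam e1 e2 : ℝ) : V9 → ℝ := fun x =>
  wA x ^ 2 + wB x ^ 2 + 2 * (x 2 + lam) * wG x - 2 * e2 * (nA2 x * x 7 + nB2 x * x 3)
    + 2 * e1 * (nB2 x * (x 1 * x 5 - x 2 * x 4) - nA2 x * (x 0 * x 8 - x 2 * x 6))
    + 2 * dotAB x * (e2 * (x 4 + x 6) + e1 * (x 5 * x 0 - x 3 * x 2 + x 7 * x 2 - x 8 * x 1))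

/-- The integral `Φ₁ = ε₁²G + K − ε₁⁴(α·β)² − ¼[H² + 2ε₁²(|α|²+|β|²)H + ε₁⁴(|α|²−|β|²)²]`
(for `ε₂ = 0`). -/
def Phi1 (lam e1 : ℝ) : V9 → ℝ := fun x =>
  e1 ^ 2 * Gfun lam e1 0 x + Kfun lam e1 0 x - e1 ^ 4 * dotAB x ^ 2
    - (Hfun lam e1 0 x ^ 2 + 2 * e1 ^ 2 * (nA2 x + nB2 x) * Hfun lam e1 0 x
        + e1 ^ 4 * (nA2 x - nB2 x) ^ 2) / 4

/-- The first integral `F₀` of the critical subsystem `M_{L₁}`. -/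
def F0 (lam e1 : ℝ) : V9 → ℝ := fun x =>
  2 * e1 * (-(x 3 + x 7) * x 2 ^ 2 - (x 3 + x 7) * (e1 * (x 6 - x 4) + lam) * x 2
    - x 3 * x 0 ^ 2 - x 7 * x 1 ^ 2 - (x 4 + x 6) * x 0 * x 1
    + (e1 * (2 * x 3 * x 8 - x 6 * x 5 - x 4 * x 5) + lam * x 5) * x 0
    - (e1 * (2 * x 7 * x 5 - x 6 * x 8 - x 4 * x 8) - lam * x 8) * x 1)

/-- The Hamiltonian vector field `sgrad f`, whose nine components are the Poisson brackets
of `f` with the nine coordinate functions. -/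
def sgrad (f : V9 → ℝ) (x : V9) : V9 := fun j => pb f (fun y => y j) x

section RankTwo

open Polynomial

variable {R ι : Type*} [CommRing R] [Fintype ι] [DecidableEq ι]
  {A : (ι → R) →ₗ[R] (ι → R)} {φ ψ : (ι → R) →ₗ[R] R} {u v : ι → R}

theorem toMatrix'_eq_mul_of_rank_two (hA : ∀ x, A x = φ x • u + ψ x • v) :
    LinearMap.toMatrix' A = (Matrix.of ![u, v]).transpose *
      Matrix.of ![fun j => φ (Pi.single j 1), fun j => ψ (Pi.single j 1)] := by
  ext i j
  simp [LinearMap.toMatrix'_apply, hA, Matrix.mul_apply, Fin.sum_univ_two, mul_comm]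

theorem of_mul_transpose_of_rank_two :
    Matrix.of ![fun j => φ (Pi.single j 1), fun j => ψ (Pi.single j 1)] *
      (Matrix.of ![u, v]).transpose = !![φ u, φ v; ψ u, ψ v] := by
  have key : ∀ (χ : (ι → R) →ₗ[R] R) (w : ι → R), ∑ j, χ (Pi.single j 1) * w j = χ w := by
    intro χ w
    conv_rhs => rw [LinearMap.pi_apply_eq_sum_univ χ w]
    refine Finset.sum_congr rfl fun j _ => ?_
    rw [smul_eq_mul, mul_comm]
    congr 2
    ext k
    simp [Pi.single_apply, eq_comm]
  ext i j
  fin_cases i <;> fin_cases j <;> simp [Matrix.mul_apply, key]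

/-- The characteristic polynomial of an endomorphism `φ ⊗ u + ψ ⊗ v` of rank at most two. -/
theorem LinearMap.charpoly_of_rank_two [Nontrivial R] (hA : ∀ x, A x = φ x • u + ψ x • v)
    (hι : 2 ≤ Fintype.card ι) :
    A.charpoly = X ^ (Fintype.card ι - 2) *
      (X ^ 2 - C (φ u + ψ v) * X + C (φ u * ψ v - φ v * ψ u)) := by
  rw [← LinearMap.charpoly_toMatrix A (Pi.basisFun R ι), LinearMap.toMatrix_eq_toMatrix',
    toMatrix'_eq_mul_of_rank_two hA, Matrix.charpoly_mul_comm_of_le _ _ (by simpa using hι),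
    of_mul_transpose_of_rank_two, Matrix.charpoly_fin_two]
  simp [Matrix.det_fin_two, Matrix.trace_fin_two]

/-- The trace of the square of an endomorphism `φ ⊗ u + ψ ⊗ v`. -/
theorem LinearMap.trace_sq_of_rank_two (hA : ∀ x, A x = φ x • u + ψ x • v) :
    LinearMap.trace R (ι → R) (A ∘ₗ A) = φ u ^ 2 + 2 * (φ v * ψ u) + ψ v ^ 2 := by
  rw [LinearMap.trace_eq_matrix_trace R (Pi.basisFun R ι), LinearMap.toMatrix_eq_toMatrix',
    LinearMap.toMatrix'_comp, toMatrix'_eq_mul_of_rank_two hA, Matrix.mul_assoc,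
    Matrix.trace_mul_comm, Matrix.mul_assoc, Matrix.mul_assoc, of_mul_transpose_of_rank_two,
    ← Matrix.mul_assoc, of_mul_transpose_of_rank_two]
  simp [Matrix.trace_fin_two]
  ring

end RankTwo

section PartialDerivatives

variable {f g : V9 → ℝ} {x : V9} (i : Fin 9)

theorem pd_const (c : ℝ) : pd i (fun _ => c) x = 0 := by simp [pd]

theorem pd_coord (j : Fin 9) : pd i (fun y => y j) x = if j = i then 1 else 0 := by
  simp [pd, (hasFDerivAt_apply j x).fderiv, Pi.single_apply]

theorem pd_neg : pd i (fun y => -f y) x = -pd i f x := by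
  simp [pd, fderiv_fun_neg]

theorem pd_add (hf : DifferentiableAt ℝ f x) (hg : DifferentiableAt ℝ g x) :
    pd i (fun y => f y + g y) x = pd i f x + pd i g x := by
  simp [pd, fderiv_fun_add hf hg]

theorem pd_sub (hf : DifferentiableAt ℝ f x) (hg : DifferentiableAt ℝ g x) :
    pd i (fun y => f y - g y) x = pd i f x - pd i g x := by
  simp [pd, fderiv_fun_sub hf hg]

theorem pd_mul (hf : DifferentiableAt ℝ f x) (hg : DifferentiableAt ℝ g x) :
    pd i (fun y => f y * g y) x = f x * pd i g x + g x * pd i f x := by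
  simp [pd, fderiv_fun_mul hf hg]

theorem pd_pow (hf : DifferentiableAt ℝ f x) (n : ℕ) :
    pd i (fun y => f y ^ n) x = n * f x ^ (n - 1) * pd i f x := by
  simp [pd, fderiv_fun_pow n hf]

theorem ContDiff.differentiable_pd (hf : ContDiff ℝ 2 f) : Differentiable ℝ (pd i f) :=
  ((hf.fderiv_right (m := 1) (by norm_num)).differentiable (by norm_num)).clm_apply
    (differentiable_const _)

theorem fderiv_apply_eq_sum_pd (v : V9) : fderiv ℝ f x v = ∑ j, v j * pd j f x := by
  conv_lhs => rw [← Finset.univ_sum_single v, map_sum]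
  refine Finset.sum_congr rfl fun j _ => ?_
  rw [pd, ← smul_eq_mul, ← map_smul, ← Pi.single_smul, smul_eq_mul, mul_one]

end PartialDerivatives

section Bracket

variable {f g : V9 → ℝ} {x : V9}

/-- The Lie–Poisson bracket written out as three triple products. -/
theorem pb_eq : pb f g x =
    (pd 0 f x * pd 1 g x - pd 1 f x * pd 0 g x) * x 2
      + (pd 1 f x * pd 2 g x - pd 2 f x * pd 1 g x) * x 0
      + (pd 2 f x * pd 0 g x - pd 0 f x * pd 2 g x) * x 1
      + (pd 0 f x * pd 4 g x - pd 0 g x * pd 4 f x - pd 1 f x * pd 3 g x + pd 1 g x * pd 3 f x)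
        * x 5
      + (pd 1 f x * pd 5 g x - pd 1 g x * pd 5 f x - pd 2 f x * pd 4 g x + pd 2 g x * pd 4 f x)
        * x 3
      + (pd 2 f x * pd 3 g x - pd 2 g x * pd 3 f x - pd 0 f x * pd 5 g x + pd 0 g x * pd 5 f x)
        * x 4
      + (pd 0 f x * pd 7 g x - pd 0 g x * pd 7 f x - pd 1 f x * pd 6 g x + pd 1 g x * pd 6 f x)
        * x 8
      + (pd 1 f x * pd 8 g x - pd 1 g x * pd 8 f x - pd 2 f x * pd 7 g x + pd 2 g x * pd 7 f x)
        * x 6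
      + (pd 2 f x * pd 6 g x - pd 2 g x * pd 6 f x - pd 0 f x * pd 8 g x + pd 0 g x * pd 8 f x)
        * x 7 := by
  have m0 : mIdx 0 = 0 := rfl
  have m1 : mIdx 1 = 1 := rfl
  have m2 : mIdx 2 = 2 := rfl
  have a0 : aIdx 0 = 3 := rfl
  have a1 : aIdx 1 = 4 := rfl
  have a2 : aIdx 2 = 5 := rfl
  have b0 : bIdx 0 = 6 := rfl
  have b1 : bIdx 1 = 7 := rfl
  have b2 : bIdx 2 = 8 := rfl
  simp only [pb, epsSym, Fin.sum_univ_three, m0, m1, m2, a0, a1, a2, b0, b1, b2, Fin.val_zero,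
    Fin.val_one, Fin.val_two]
  push_cast
  ring

theorem pb_self : pb f f x = 0 := by
  rw [pb_eq]
  ring

theorem pb_antisymm : pb g f x = -pb f g x := by
  rw [pb_eq, pb_eq]
  ring

/-- The derivative of `g` along the Hamiltonian field of `f` is the bracket `{f, g}`. -/
theorem fderiv_apply_sgrad : fderiv ℝ g x (sgrad f x) = pb f g x := by
  rw [fderiv_apply_eq_sum_pd]
  simp only [sgrad, pb_eq, pd_coord, Fin.sum_univ_succ, Fin.sum_univ_zero]
  simp
  ring

theorem sgrad_mul (hf : DifferentiableAt ℝ f x) (hg : DifferentiableAt ℝ g x) :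
    sgrad (fun y => f y * g y) x = f x • sgrad g x + g x • sgrad f x := by
  ext j
  simp only [sgrad, pb_eq, pd_mul _ hf hg, Pi.add_apply, Pi.smul_apply, smul_eq_mul]
  ring

theorem ContDiff.differentiable_sgrad (hf : ContDiff ℝ 2 f) : Differentiable ℝ (sgrad f) := by
  have hpd := fun i => hf.differentiable_pd i
  rw [differentiable_pi]
  intro j
  simp only [sgrad, pb_eq, pd_coord]
  fun_prop

/-- On the common zero level of `f` and `g`, the linearization of `sgrad (f * g)` is
`df ⊗ sgrad g + dg ⊗ sgrad f`. -/
theorem fderiv_sgrad_mul_apply (hf : ContDiff ℝ 2 f) (hg : ContDiff ℝ 2 g)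
    (hfx : f x = 0) (hgx : g x = 0) (v : V9) :
    fderiv ℝ (sgrad fun y => f y * g y) x v =
      fderiv ℝ f x v • sgrad g x + fderiv ℝ g x v • sgrad f x := by
  have hfd : Differentiable ℝ f := hf.differentiable (by norm_num)
  have hgd : Differentiable ℝ g := hg.differentiable (by norm_num)
  have hmul : sgrad (fun y => f y * g y) = fun y => f y • sgrad g y + g y • sgrad f y :=
    funext fun y => sgrad_mul (hfd y) (hgd y)
  have hderiv := ((hfd x).hasFDerivAt.fun_smul (hg.differentiable_sgrad x).hasFDerivAt).fun_add
    ((hgd x).hasFDerivAt.fun_smul (hf.differentiable_sgrad x).hasFDerivAt)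
  rw [hmul, hderiv.fderiv]
  simp [hfx, hgx]

end Bracket

section InvariantRelations

variable (lam e1 : ℝ)

/-- For `ε₂ = 0` the integral `Φ₁` factors through the two invariant relations. -/
theorem Phi1_eq_mul : Phi1 lam e1 = fun x => F1 lam e1 x * -F2 lam e1 x := by
  ext x
  simp only [Phi1, Gfun, Kfun, Hfun, Z1, Z2, nA2, nB2, dotAB, wA, wB, wG, F1, F2]
  ring

theorem contDiff_F1 {n : WithTop ℕ∞} : ContDiff ℝ n (F1 lam e1) := by
  unfold F1
  fun_prop

theorem contDiff_F2 {n : WithTop ℕ∞} : ContDiff ℝ n (F2 lam e1) := by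
  unfold F2
  fun_prop

theorem pb_F1_neg_F2 (x : V9) : pb (F1 lam e1) (fun y => -F2 lam e1 y) x = -F0 lam e1 x := by
  unfold F1 F2 F0
  simp (disch := fun_prop) only [pb_eq, pd_neg, pd_add, pd_sub, pd_mul, pd_pow, pd_const, pd_coord]
  simp
  ring

end InvariantRelations

/-- For `ε₂ = 0`, at every point of the critical subsystem `M_{L₁}` the linearization `A` of
`sgrad Φ₁` has characteristic polynomial `X⁹ − F₀²·X⁷`, and the coefficient satisfies
`C = ½ tr(A²) = F₀²`. -/
theorem charpoly_Phi1 (lam e1 : ℝ) (x₀ : V9)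
    (h1 : F1 lam e1 x₀ = 0) (h2 : F2 lam e1 x₀ = 0) :
    let A : V9 →ₗ[ℝ] V9 := (fderiv ℝ (sgrad (Phi1 lam e1)) x₀).toLinearMap
    LinearMap.charpoly A
        = Polynomial.X ^ 9 - Polynomial.C (F0 lam e1 x₀ ^ 2) * Polynomial.X ^ 7
      ∧ F0 lam e1 x₀ ^ 2 = (1 / 2) * LinearMap.trace ℝ V9 (A ∘ₗ A) := by
  intro A
  have hA := fderiv_sgrad_mul_apply (contDiff_F1 lam e1) (contDiff_F2 lam e1).neg h1
    (neg_eq_zero.mpr h2)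
  rw [← Phi1_eq_mul] at hA
  have h12 := pb_F1_neg_F2 lam e1 x₀
  have hcp := LinearMap.charpoly_of_rank_two (A := A)
    (φ := (fderiv ℝ (F1 lam e1) x₀).toLinearMap)
    (ψ := (fderiv ℝ (fun y => -F2 lam e1 y) x₀).toLinearMap) hA (by simp)
  have htr := LinearMap.trace_sq_of_rank_two (A := A)
    (φ := (fderiv ℝ (F1 lam e1) x₀).toLinearMap)
    (ψ := (fderiv ℝ (fun y => -F2 lam e1 y) x₀).toLinearMap) hA
  simp only [ContinuousLinearMap.coe_coe, fderiv_apply_sgrad, pb_self,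
    pb_antisymm (f := F1 lam e1) (g := fun y => -F2 lam e1 y), h12] at hcp htr
  constructor
  · rw [hcp]
    simp
    ring
  · rw [htr]
    ring
end
end
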